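/- arXiv:2405.01312 — 5 statements merged into one kernel-verified Lean document; each statement's English description precedes it below -/
import Mathlib

section
/- Parallel composition under bounded differential privacy (Theorem 'sumnode'): Let S_1, …, S_K be pairwise disjoint subsets of Fin n whose union is all of Fin n (a partition of the row indices). For each k ∈ [K], let M_k be a randomized mechanism taking tables indexed by S_k (functions from the subtype {i // i ∈ S_k} to R) to probability mass functions over an outcome type Ω_k, and suppose each M_k satisfies ε_k-DP with respect to tables on S_k that differ in at most one coordinate. Then the composite mechanism T ↦ (M_1(T restricted to S_1), …, M_K(T restricted to S_K)), taken as the independent product of the K output distributions, satisfies table-level (max{ε_1, …, ε_K})-DP on tables T : Fin n → R. -/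
open MeasureTheory

/-- Two tables (functions on an index type) differ in at most `τ` coordinates. -/
def DiffAtMost {ι R : Type*} (τ : ℕ) (T T' : ι → R) : Prop :=
  ∃ s : Finset ι, s.card ≤ τ ∧ ∀ i ∉ s, T i = T' i

/-- A randomized mechanism mapping tables to PMFs satisfies table-level `ε`-DP
(bounded interpretation: neighboring tables differ in at most one coordinate). -/
def IsDP {ι R Ω : Type*} (M : (ι → R) → PMF Ω) (ε : ℝ) : Prop :=
  ∀ T T' : ι → R, DiffAtMost 1 T T' → ∀ S : Set Ω,
    (M T).toOuterMeasure S ≤ ENNReal.ofReal (Real.exp ε) * (M T').toOuterMeasure S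

namespace MeasureTheory.Measure

/-- If the products of the marginals are bounded on all rectangles up to a constant factor,
then so are the product measures. -/
theorem pi_le_smul_pi {ι : Type*} [Fintype ι] {α : ι → Type*} [∀ i, MeasurableSpace (α i)]
    {μ ν : ∀ i, Measure (α i)} [∀ i, SigmaFinite (μ i)] {c : ENNReal} (hc : c ≠ 0)
    (hc' : c ≠ ⊤) (h : ∀ s : ∀ i, Set (α i), ∏ i, μ i (s i) ≤ c * ∏ i, ν i (s i)) :
    Measure.pi μ ≤ c • Measure.pi ν := by
  have key : c⁻¹ • (Measure.pi μ).toOuterMeasure ≤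
      OuterMeasure.pi fun i => (ν i).toOuterMeasure := by
    refine OuterMeasure.le_pi.2 fun s _ => ?_
    change c⁻¹ * Measure.pi μ (Set.univ.pi s) ≤ ∏ i, ν i (s i)
    rw [Measure.pi_pi, ENNReal.inv_mul_le_iff hc hc']
    exact h s
  refine Measure.le_iff.2 fun s hs => ?_
  rw [Measure.smul_apply, smul_eq_mul, ← ENNReal.inv_mul_le_iff hc hc']
  rw [Measure.pi_def ν, toMeasure_apply _ _ hs]
  exact key s

end MeasureTheory.Measure

/-- Two tables on disjoint blocks of rows that differ in at most one row agree on all blocks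
except possibly one. -/
theorem DiffAtMost.exists_forall_ne_restrict_eq {ι κ R : Type*} [Nonempty κ] {S : κ → Set ι}
    (hdisj : Pairwise fun k l => Disjoint (S k) (S l)) {T T' : ι → R}
    (hT : DiffAtMost 1 T T') :
    ∃ k, ∀ l ≠ k, (fun i : S l => T i.1) = fun i : S l => T' i.1 := by
  obtain ⟨s, hs, hTs⟩ := hT
  by_cases h : ∃ k, ∃ i ∈ S k, i ∈ s
  · obtain ⟨k, i, hik, his⟩ := h
    refine ⟨k, fun l hl => funext fun j => hTs j fun hj => ?_⟩
    have hji : j.1 = i := Finset.card_le_one.1 hs _ hj _ his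
    exact Set.disjoint_left.1 (hdisj hl) j.2 (hji ▸ hik)
  · push Not at h
    exact ⟨Classical.arbitrary κ, fun l _ => funext fun j => hTs j (h l j j.2)⟩

/-- Restricting neighboring tables to a set of rows gives neighboring tables. -/
theorem DiffAtMost.restrict {ι R : Type*} {τ : ℕ} {T T' : ι → R} (hT : DiffAtMost τ T T')
    (S : Set ι) : DiffAtMost τ (fun i : S => T i.1) fun i : S => T' i.1 := by
  classical
  obtain ⟨s, hs, hTs⟩ := hT
  refine ⟨s.subtype (· ∈ S), ?_, fun i hi => hTs i fun his => hi (Finset.mem_subtype.2 his)⟩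
  rw [Finset.card_subtype]
  exact (Finset.card_filter_le _ _).trans hs

/-- The output measures of a differentially private mechanism on neighboring tables. -/
theorem IsDP.toMeasure_le {ι R Ω : Type*} [MeasurableSpace Ω] {M : (ι → R) → PMF Ω} {ε : ℝ}
    (hM : IsDP M ε) {T T' : ι → R} (hT : DiffAtMost 1 T T') :
    (M T).toMeasure ≤ ENNReal.ofReal (Real.exp ε) • (M T').toMeasure := by
  refine Measure.le_iff.2 fun s hs => ?_
  rw [Measure.smul_apply, smul_eq_mul, PMF.toMeasure_apply_eq_toOuterMeasure_apply _ hs,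
    PMF.toMeasure_apply_eq_toOuterMeasure_apply _ hs]
  exact hM T T' hT s

/-- Parallel composition under bounded DP: if the row indices `Fin n` are
partitioned into `S 1, …, S K` and each mechanism `M k` acting on the rows in
`S k` is `ε k`-DP, then publishing all `K` outputs independently is
`(max_k ε k)`-DP on the whole table. -/
theorem parallel_composition_bounded_dp {n K : ℕ} (hK : 0 < K) {R : Type*}
    {Ω : Fin K → Type*} [∀ k, MeasurableSpace (Ω k)]
    (S : Fin K → Set (Fin n))
    (hdisj : Pairwise fun k l => Disjoint (S k) (S l))
    (hcover : (⋃ k, S k) = Set.univ)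
    (ε : Fin K → ℝ)
    (M : (k : Fin K) → ((S k → R) → PMF (Ω k)))
    (hM : ∀ k, IsDP (M k) (ε k))
    (T T' : Fin n → R) (hT : DiffAtMost 1 T T')
    (B : Set ((k : Fin K) → Ω k)) :
    Measure.pi (fun k => (M k fun i => T i.1).toMeasure) B
      ≤ ENNReal.ofReal (Real.exp (⨆ k, ε k)) *
        Measure.pi (fun k => (M k fun i => T' i.1).toMeasure) B := by
  have : Nonempty (Fin K) := ⟨⟨0, hK⟩⟩
  obtain ⟨k, hk⟩ := hT.exists_forall_ne_restrict_eq hdisj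
  refine Measure.pi_le_smul_pi (by simp [Real.exp_pos]) ENNReal.ofReal_ne_top (fun s => ?_) B
  rw [← Finset.mul_prod_erase _ _ (Finset.mem_univ k),
    ← Finset.mul_prod_erase _ (fun l => (M l fun i => T' i.1).toMeasure (s l))
      (Finset.mem_univ k), ← mul_assoc]
  refine mul_le_mul' (((hM k).toMeasure_le (hT.restrict (S k)) (s k)).trans ?_)
    (Finset.prod_congr rfl fun l hl => ?_).le
  · rw [Measure.smul_apply, smul_eq_mul]
    gcongr
    exact le_ciSup (Set.finite_range ε).bddAbove k
  · rw [hk l (Finset.ne_of_mem_erase hl)]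
end

section
/- Database-level composition (Theorem 'table-to-db'): Let a database consist of n tables, where the i-th table is a function T_i : Fin m_i → R_i, and let τ_1, …, τ_n be positive integers. For each i, let M_i be a randomized mechanism mapping tables Fin m_i → R_i to PMFs over Ω_i that satisfies table-level ε_i-DP. Then for any two databases D = (T_1, …, T_n) and D' = (T_1', …, T_n') such that for every i the tables T_i and T_i' differ in at most τ_i coordinates, and for every set S of joint outcomes, the probability that the independent composite output (M_1(T_1), …, M_n(T_n)) lies in S is at most exp(Σ_{i∈[n]} τ_i · ε_i) times the probability that (M_1(T_1'), …, M_n(T_n')) lies in S. -/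
open MeasureTheory

theorem DiffAtMost.exists_intermediate {ι R : Type*} {k : ℕ} {T T' : ι → R}
    (h : DiffAtMost (k + 1) T T') :
    ∃ U : ι → R, DiffAtMost k T U ∧ DiffAtMost 1 U T' := by
  classical
  obtain ⟨s, hs, hT⟩ := h
  rcases s.eq_empty_or_nonempty with rfl | ⟨a, ha⟩
  · exact ⟨T, ⟨∅, by simp, fun _ _ => rfl⟩, ⟨∅, by simp, hT⟩⟩
  · refine ⟨Function.update T' a (T a), ⟨s.erase a, ?_, fun i hi => ?_⟩,
      ⟨{a}, by simp, fun i hi => ?_⟩⟩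
    · rw [Finset.card_erase_of_mem ha]
      omega
    · by_cases hia : i = a
      · subst hia
        simp
      · rw [Function.update_of_ne hia]
        exact hT i fun his => hi (Finset.mem_erase.2 ⟨hia, his⟩)
    · exact Function.update_of_ne (by simpa using hi) _ _

/-- Group privacy: `ε`-DP degrades to `k * ε` for tables that differ in at most `k` rows. -/
theorem IsDP.group_privacy {ι R Ω : Type*} {M : (ι → R) → PMF Ω} {ε : ℝ} (hM : IsDP M ε)
    {k : ℕ} {T T' : ι → R} (h : DiffAtMost k T T') (S : Set Ω) :
    (M T).toOuterMeasure S ≤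
      ENNReal.ofReal (Real.exp (k * ε)) * (M T').toOuterMeasure S := by
  induction k generalizing T' with
  | zero =>
    obtain ⟨s, hs, hT⟩ := h
    obtain rfl : s = ∅ := by simpa using hs
    obtain rfl : T = T' := funext fun i => hT i (by simp)
    simp
  | succ k ih =>
    obtain ⟨U, hTU, hUT'⟩ := h.exists_intermediate
    calc (M T).toOuterMeasure S
        ≤ ENNReal.ofReal (Real.exp (k * ε)) * (M U).toOuterMeasure S := ih hTU
      _ ≤ ENNReal.ofReal (Real.exp (k * ε)) *
            (ENNReal.ofReal (Real.exp ε) * (M T').toOuterMeasure S) := by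
          gcongr
          exact hM U T' hUT' S
      _ = ENNReal.ofReal (Real.exp ((k + 1 : ℕ) * ε)) * (M T').toOuterMeasure S := by
          rw [← mul_assoc, ← ENNReal.ofReal_mul (Real.exp_nonneg _), ← Real.exp_add]
          push_cast
          ring_nf

theorem MeasureTheory.Measure.pi_le_smul_pi_s2 {ι : Type*} [Fintype ι] {α : ι → Type*}
    [∀ i, MeasurableSpace (α i)] {μ ν : ∀ i, Measure (α i)} [∀ i, SigmaFinite (μ i)]
    {c : ι → ENNReal} (hc : ∀ i, c i ≠ ⊤) (h : ∀ i, μ i ≤ c i • ν i) :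
    Measure.pi μ ≤ (∏ i, c i) • Measure.pi ν := by
  have hC : ∏ i, c i ≠ ⊤ := ENNReal.prod_ne_top fun i _ => hc i
  have houter : (Measure.pi μ).toOuterMeasure ≤
      (∏ i, c i) • OuterMeasure.pi fun i => (ν i).toOuterMeasure := by
    rw [OuterMeasure.pi, OuterMeasure.smul_boundedBy hC, OuterMeasure.le_boundedBy]
    intro s
    calc Measure.pi μ s
        ≤ Measure.pi μ (Set.univ.pi fun i => Function.eval i '' s) :=
          measure_mono (Set.subset_pi_eval_image Set.univ s)
      _ = ∏ i, μ i (Function.eval i '' s) := Measure.pi_pi _ _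
      _ ≤ ∏ i, c i * ν i (Function.eval i '' s) :=
          Finset.prod_le_prod' fun i _ => h i _
      _ = (∏ i, c i) * ∏ i, ν i (Function.eval i '' s) := Finset.prod_mul_distrib
  refine Measure.le_iff.2 fun s hs => ?_
  rw [Measure.smul_apply, Measure.pi_def ν, toMeasure_apply _ _ hs]
  exact houter s

/-- Database-level composition: if each mechanism `M i` is table-level `ε i`-DP
and the databases `D, D'` have `i`-th tables differing in at most `τ i` rows,
then publishing all `n` outputs independently is
`(∑ i, τ i · ε i)`-indistinguishable on `D` and `D'`. -/
theorem database_level_composition {n : ℕ} {m : Fin n → ℕ} {R : Fin n → Type*}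
    {Ω : Fin n → Type*} [∀ i, MeasurableSpace (Ω i)]
    (τ : Fin n → ℕ) (hτ : ∀ i, 0 < τ i) (ε : Fin n → ℝ)
    (M : (i : Fin n) → ((Fin (m i) → R i) → PMF (Ω i)))
    (hM : ∀ i, IsDP (M i) (ε i))
    (D D' : (i : Fin n) → Fin (m i) → R i)
    (hD : ∀ i, DiffAtMost (τ i) (D i) (D' i))
    (S : Set ((i : Fin n) → Ω i)) :
    Measure.pi (fun i => (M i (D i)).toMeasure) S
      ≤ ENNReal.ofReal (Real.exp (∑ i, (τ i : ℝ) * ε i)) *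
        Measure.pi (fun i => (M i (D' i)).toMeasure) S := by
  have hle (i : Fin n) : (M i (D i)).toMeasure ≤
      ENNReal.ofReal (Real.exp (τ i * ε i)) • (M i (D' i)).toMeasure := by
    refine Measure.le_iff.2 fun s hs => ?_
    rw [Measure.smul_apply, PMF.toMeasure_apply_eq_toOuterMeasure_apply _ hs,
      PMF.toMeasure_apply_eq_toOuterMeasure_apply _ hs]
    exact (hM i).group_privacy (hD i) s
  rw [Real.exp_sum, ENNReal.ofReal_prod_of_nonneg fun i _ => Real.exp_nonneg _]
  exact Measure.pi_le_smul_pi_s2 (fun _ => ENNReal.ofReal_ne_top) hle S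
end

section
/- The scalar Laplace mechanism satisfies ε-DP: Let f be a real-valued function on tables T : Fin n → R such that |f(T) − f(T')| ≤ Δ for all neighboring tables T, T', where Δ > 0, and let ε > 0. Define the mechanism M(T) to be the probability measure on ℝ with density x ↦ (ε / (2Δ)) · exp(−ε · |x − f(T)| / Δ) with respect to Lebesgue measure. Then for all neighboring tables T, T' and every measurable set S ⊆ ℝ, M(T)(S) ≤ exp(ε) · M(T')(S). -/
open MeasureTheory

/-- The Laplace distribution centered at `μ` with scale `b`: the measure on `ℝ`
with Lebesgue density `x ↦ (1/(2b)) · exp (−|x − μ|/b)`. -/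
noncomputable def laplaceMeasure (μ b : ℝ) : Measure ℝ :=
  (volume : Measure ℝ).withDensity fun x => ENNReal.ofReal ((1 / (2 * b)) * Real.exp (-|x - μ| / b))

/-- Moving the center of a Laplace distribution of scale `b` by at most `c * b` changes
probabilities by a factor of at most `exp c`. -/
theorem laplaceMeasure_le_exp_mul {μ ν b c : ℝ} (hb : 0 < b) (h : |μ - ν| ≤ c * b) (S : Set ℝ)
    (hS : MeasurableSet S) :
    laplaceMeasure μ b S ≤ ENNReal.ofReal (Real.exp c) * laplaceMeasure ν b S := by
  rw [laplaceMeasure, laplaceMeasure, withDensity_apply _ hS, withDensity_apply _ hS,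
    ← lintegral_const_mul' _ _ ENNReal.ofReal_ne_top]
  refine lintegral_mono fun x => ?_
  rw [← ENNReal.ofReal_mul (Real.exp_nonneg c), mul_left_comm, ← Real.exp_add]
  have htri : |x - ν| ≤ |x - μ| + |μ - ν| := abs_sub_le x μ ν
  have hexp : -|x - μ| / b ≤ c + -|x - ν| / b := by
    rw [div_le_iff₀ hb, add_mul, div_mul_cancel₀ _ hb.ne']
    linarith
  gcongr

/-- The scalar Laplace mechanism satisfies `ε`-DP: adding Laplace noise of scale
`Δ/ε` to a real-valued query of sensitivity `Δ` is `ε`-differentially private. -/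
theorem laplace_mechanism_dp {n : ℕ} {R : Type*} (f : (Fin n → R) → ℝ) (Δ ε : ℝ)
    (hΔ : 0 < Δ) (hε : 0 < ε)
    (hsens : ∀ T T' : Fin n → R, DiffAtMost 1 T T' → |f T - f T'| ≤ Δ)
    (T T' : Fin n → R) (hT : DiffAtMost 1 T T') (S : Set ℝ) (hS : MeasurableSet S) :
    laplaceMeasure (f T) (Δ / ε) S ≤ ENNReal.ofReal (Real.exp ε) * laplaceMeasure (f T') (Δ / ε) S := by
  refine laplaceMeasure_le_exp_mul (div_pos hΔ hε) ?_ S hS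
  rw [mul_div_cancel₀ Δ hε.ne']
  exact hsens T T' hT
end

section
/- The multidimensional Laplace mechanism satisfies ε-DP: Let f map tables T : Fin n → R to vectors in ℝ^d (functions Fin d → ℝ), and assume the ℓ1-sensitivity bound Σ_{k∈Fin d} |f(T) k − f(T') k| ≤ Δ for all neighboring tables T, T', with Δ > 0 and ε > 0. Define M(T) to be the product measure on ℝ^d whose k-th marginal has Lebesgue density x ↦ (ε/(2Δ)) · exp(−ε · |x − f(T) k| / Δ). Then for all neighboring tables T, T' and every measurable set S ⊆ ℝ^d, M(T)(S) ≤ exp(ε) · M(T')(S). -/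
open MeasureTheory

/-- Domination up to constants passes from the factors to finite products of measures. -/
theorem measure_pi_le_prod_smul_pi {ι : Type*} [Fintype ι] {α : ι → Type*}
    [∀ i, MeasurableSpace (α i)] {μ ν : ∀ i, Measure (α i)} {c : ι → ENNReal}
    (hc₀ : ∀ i, c i ≠ 0) (hc : ∀ i, c i ≠ ⊤) (h : ∀ i, μ i ≤ c i • ν i) :
    Measure.pi μ ≤ (∏ i, c i) • Measure.pi ν := by
  have hC₀ : ∏ i, c i ≠ 0 := Finset.prod_ne_zero_iff.2 fun i _ => hc₀ i
  have hC : ∏ i, c i ≠ ⊤ := ENNReal.prod_ne_top fun i _ => hc i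
  have key : (∏ i, c i)⁻¹ • OuterMeasure.pi (fun i => (μ i).toOuterMeasure) ≤
      OuterMeasure.pi fun i => (ν i).toOuterMeasure := by
    refine OuterMeasure.le_pi.2 fun s _ => ?_
    rw [smul_apply, smul_eq_mul, ENNReal.inv_mul_le_iff hC₀ hC,
      ← Finset.prod_mul_distrib]
    exact (OuterMeasure.pi_pi_le _ _).trans (Finset.prod_le_prod' fun i _ => h i (s i))
  refine Measure.le_iff.2 fun S hS => ?_
  have hkey := key S
  rw [smul_apply, smul_eq_mul, ENNReal.inv_mul_le_iff hC₀ hC] at hkey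
  simpa [Measure.pi, toMeasure_apply _ _ hS] using hkey

/-- Shifting the center of a Laplace distribution of scale `b` by `t` changes it by a factor
of at most `exp (|t| / b)`. -/
theorem laplaceMeasure_le_smul (μ ν : ℝ) {b : ℝ} (hb : 0 < b) :
    laplaceMeasure μ b ≤ ENNReal.ofReal (Real.exp (|μ - ν| / b)) • laplaceMeasure ν b := by
  unfold laplaceMeasure
  rw [← withDensity_smul _ (by fun_prop)]
  refine withDensity_mono (.of_forall fun x => ?_)
  rw [Pi.smul_apply, smul_eq_mul, ← ENNReal.ofReal_mul (Real.exp_pos _).le, mul_left_comm,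
    ← Real.exp_add, ← add_div]
  beta_reduce
  gcongr
  linarith [abs_sub_le x μ ν]

/-- The multidimensional Laplace mechanism satisfies `ε`-DP: adding independent
Laplace noise of scale `Δ/ε` to each coordinate of a vector-valued query of
ℓ₁-sensitivity `Δ` is `ε`-differentially private. -/
theorem multidim_laplace_mechanism_dp {n d : ℕ} {R : Type*}
    (f : (Fin n → R) → (Fin d → ℝ)) (Δ ε : ℝ) (hΔ : 0 < Δ) (hε : 0 < ε)
    (hsens : ∀ T T' : Fin n → R, DiffAtMost 1 T T' → ∑ k : Fin d, |f T k - f T' k| ≤ Δ)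
    (T T' : Fin n → R) (hT : DiffAtMost 1 T T')
    (S : Set (Fin d → ℝ)) (hS : MeasurableSet S) :
    Measure.pi (fun k => laplaceMeasure (f T k) (Δ / ε)) S
      ≤ ENNReal.ofReal (Real.exp ε) * Measure.pi (fun k => laplaceMeasure (f T' k) (Δ / ε)) S := by
  have hb : 0 < Δ / ε := div_pos hΔ hε
  refine (measure_pi_le_prod_smul_pi (fun k => (ENNReal.ofReal_pos.2 (Real.exp_pos _)).ne')
    (fun _ => ENNReal.ofReal_ne_top) (fun k => laplaceMeasure_le_smul (f T k) (f T' k) hb)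
    S).trans ?_
  rw [Measure.smul_apply, smul_eq_mul, ← ENNReal.ofReal_prod_of_nonneg
    (fun _ _ => (Real.exp_pos _).le), ← Real.exp_sum, ← Finset.sum_div]
  gcongr
  rw [div_le_iff₀ hb, mul_div_cancel₀ _ hε.ne']
  exact hsens T T' hT
end

section
/- The exponential mechanism satisfies ε-DP: Let Ω be a nonempty finite output type, let u be a utility function assigning to each table T : Fin n → R and each r ∈ Ω a real score u(T, r), and suppose Δ > 0 is a sensitivity bound such that |u(T, r) − u(T', r)| ≤ Δ for all neighboring tables T, T' and all r ∈ Ω. For ε > 0, define the mechanism M(T) to be the PMF on Ω assigning to each r probability exp(ε · u(T, r) / (2Δ)) divided by Σ_{r' ∈ Ω} exp(ε · u(T, r') / (2Δ)). Then M satisfies table-level ε-DP: for all neighboring tables T, T' and every set S ⊆ Ω, the probability that M(T) lies in S is at most exp(ε) times the probability that M(T') lies in S. -/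
/-- The exponential mechanism: output `r` with probability proportional to
`exp (ε · u(T, r) / (2Δ))`. -/
noncomputable def expMech {n : ℕ} {R Ω : Type*} [Fintype Ω] [Nonempty Ω]
    (u : (Fin n → R) → Ω → ℝ) (Δ ε : ℝ) (T : Fin n → R) : PMF Ω :=
  PMF.ofFintype
    (fun r => ENNReal.ofReal
      (Real.exp (ε * u T r / (2 * Δ)) / ∑ r' : Ω, Real.exp (ε * u T r' / (2 * Δ))))
    (by
      have hD : 0 < ∑ r' : Ω, Real.exp (ε * u T r' / (2 * Δ)) :=
        Finset.sum_pos (fun r _ => Real.exp_pos _) Finset.univ_nonempty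
      rw [← ENNReal.ofReal_sum_of_nonneg (fun r _ => by positivity), ← Finset.sum_div,
        div_self hD.ne', ENNReal.ofReal_one])

/-- A pointwise bound on mass functions transfers to all events. -/
theorem isDP_of_apply_le {ι R Ω : Type*} {M : (ι → R) → PMF Ω} {ε : ℝ}
    (h : ∀ T T' : ι → R, DiffAtMost 1 T T' → ∀ r : Ω,
      M T r ≤ ENNReal.ofReal (Real.exp ε) * M T' r) :
    IsDP M ε := by
  intro T T' hT S
  rw [PMF.toOuterMeasure_apply, PMF.toOuterMeasure_apply, ← ENNReal.tsum_mul_left]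
  refine ENNReal.tsum_le_tsum fun r => ?_
  by_cases hr : r ∈ S
  · simpa [hr] using h T T' hT r
  · simp [hr]

/-- If two families of scores differ by at most `c` pointwise, then their softmax weights differ
by a factor of at most `exp (2 * c)`. -/
theorem exp_div_sum_exp_le {Ω : Type*} [Fintype Ω] [Nonempty Ω] {f g : Ω → ℝ} {c : ℝ}
    (h : ∀ r, |f r - g r| ≤ c) (r : Ω) :
    Real.exp (f r) / ∑ r', Real.exp (f r') ≤
      Real.exp (2 * c) * (Real.exp (g r) / ∑ r', Real.exp (g r')) := by
  have sum_exp_pos (k : Ω → ℝ) : 0 < ∑ r', Real.exp (k r') :=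
    Finset.sum_pos (fun _ _ => Real.exp_pos _) Finset.univ_nonempty
  have hnum : Real.exp (f r) ≤ Real.exp c * Real.exp (g r) := by
    rw [← Real.exp_add, Real.exp_le_exp]
    linarith [(abs_le.mp (h r)).2]
  have hden : ∑ r', Real.exp (g r') ≤ Real.exp c * ∑ r', Real.exp (f r') := by
    rw [Finset.mul_sum]
    refine Finset.sum_le_sum fun r' _ => ?_
    rw [← Real.exp_add, Real.exp_le_exp]
    linarith [(abs_le.mp (h r')).1]
  rw [← mul_div_assoc, div_le_div_iff₀ (sum_exp_pos f) (sum_exp_pos g)]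
  calc Real.exp (f r) * ∑ r', Real.exp (g r')
      ≤ (Real.exp c * Real.exp (g r)) * (Real.exp c * ∑ r', Real.exp (f r')) := by
        gcongr
    _ = Real.exp (2 * c) * Real.exp (g r) * ∑ r', Real.exp (f r') := by
        rw [two_mul, Real.exp_add]
        ring

/-- The exponential mechanism satisfies `ε`-DP, provided the utility function
has sensitivity at most `Δ` on neighboring tables. -/
theorem exponential_mechanism_dp {n : ℕ} {R Ω : Type*} [Fintype Ω] [Nonempty Ω]
    (u : (Fin n → R) → Ω → ℝ) (Δ ε : ℝ) (hΔ : 0 < Δ) (hε : 0 < ε)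
    (hsens : ∀ T T' : Fin n → R, DiffAtMost 1 T T' → ∀ r : Ω, |u T r - u T' r| ≤ Δ) :
    IsDP (expMech u Δ ε) ε := by
  refine isDP_of_apply_le fun T T' hT r => ?_
  simp only [expMech, PMF.ofFintype_apply]
  rw [← ENNReal.ofReal_mul (Real.exp_pos ε).le]
  refine ENNReal.ofReal_le_ofReal ?_
  have hscore (r : Ω) : |ε * u T r / (2 * Δ) - ε * u T' r / (2 * Δ)| ≤ ε / 2 := by
    rw [← sub_div, ← mul_sub, abs_div, abs_mul, abs_of_pos hε,
      abs_of_pos (by positivity : 0 < 2 * Δ), div_le_iff₀ (by positivity)]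
    calc ε * |u T r - u T' r| ≤ ε * Δ := by
          gcongr
          exact hsens T T' hT r
      _ = ε / 2 * (2 * Δ) := by ring
  have hexp : 2 * (ε / 2) = ε := by ring
  simpa only [hexp] using exp_div_sum_exp_le hscore r
end
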